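/- arXiv:2311.14121 — 5 statements merged into one kernel-verified Lean document; each statement's English description precedes it below -/
import Mathlib

section
/- Let A : ℝ → Matrix (Fin n) (Fin n) ℝ be measurable and bounded and let Φ_A be its fundamental matrix. Then for all t, s ∈ ℝ the matrix Φ_A(t, s) is invertible, with inverse Φ_A(s, t). -/
open MeasureTheory

/-- Forward Grönwall inequality in integral form with zero initial value. -/
theorem eq_zero_of_le_mul_integral_of_le {g : ℝ → ℝ} (hg : Continuous g) (h0 : ∀ t, 0 ≤ g t)
    {K s : ℝ} (hle : ∀ t, g t ≤ K * |∫ r in s..t, g r|) {t : ℝ} (hst : s ≤ t) : g t = 0 := by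
  have hd : ∀ x, HasDerivAt (fun x => ∫ r in s..x, g r) (g x) x := fun x =>
    intervalIntegral.integral_hasDerivAt_right (hg.intervalIntegrable _ _)
      (hg.stronglyMeasurableAtFilter _ _) hg.continuousAt
  have hG := norm_le_gronwallBound_of_norm_deriv_right_le (f := fun x => ∫ r in s..x, g r)
    (f' := g) (δ := 0) (K := K) (ε := 0) (a := s) (b := t)
    (fun x _ => (hd x).continuousAt.continuousWithinAt)
    (fun x _ => (hd x).hasDerivWithinAt) (by simp)
    (fun x _ => by simpa [Real.norm_eq_abs, abs_of_nonneg (h0 x)] using hle x)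
    t ⟨hst, le_rfl⟩
  have hz : |∫ r in s..t, g r| = 0 :=
    le_antisymm (by simpa [gronwallBound_ε0] using hG) (abs_nonneg _)
  exact le_antisymm (by simpa [hz] using hle t) (h0 t)

/-- Two-sided Grönwall inequality in integral form with zero initial value. -/
theorem eq_zero_of_le_mul_abs_integral {g : ℝ → ℝ} (hg : Continuous g) (h0 : ∀ t, 0 ≤ g t)
    {K s : ℝ} (hle : ∀ t, g t ≤ K * |∫ r in s..t, g r|) (t : ℝ) : g t = 0 := by
  rcases le_total s t with h | h
  · exact eq_zero_of_le_mul_integral_of_le hg h0 hle h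
  · have := eq_zero_of_le_mul_integral_of_le (g := fun x => g (-x)) (K := K) (s := -s) (t := -t)
      (by fun_prop) (fun x => h0 _)
      (fun x => by
        rw [intervalIntegral.integral_comp_neg, neg_neg, intervalIntegral.integral_symm, abs_neg]
        exact hle (-x)) (neg_le_neg h)
    simpa using this

/-- A pointwise finite sum of interval integrable functions is interval integrable. -/
theorem intervalIntegrable_sum_apply {ι : Type*} [Fintype ι] {f : ι → ℝ → ℝ} {a b : ℝ}
    (h : ∀ i, IntervalIntegrable (f i) volume a b) :
    IntervalIntegrable (fun r => ∑ i, f i r) volume a b := by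
  simpa only [Finset.sum_fn] using IntervalIntegrable.sum Finset.univ fun i _ => h i

section LinearEquation

variable {n : ℕ} {A : ℝ → Matrix (Fin n) (Fin n) ℝ}

/-- The only continuous solution of the homogeneous linear integral equation is zero. -/
theorem eq_zero_of_eq_integral_mul (hAbdd : ∃ C : ℝ, ∀ t i j, |A t i j| ≤ C)
    {Ψ : ℝ → Matrix (Fin n) (Fin n) ℝ} (hΨ : ∀ i j, Continuous fun t => Ψ t i j) {s : ℝ}
    (heq : ∀ t i j, Ψ t i j = ∫ r in s..t, (A r * Ψ r) i j) (t : ℝ) : Ψ t = 0 := by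
  obtain ⟨C, hC⟩ := hAbdd
  have hg : Continuous fun t => ∑ i, ∑ j, |Ψ t i j| := by fun_prop
  have hentry : ∀ r k j, |Ψ r k j| ≤ ∑ i, ∑ j, |Ψ r i j| := fun r k j =>
    (Finset.single_le_sum (f := fun j => |Ψ r k j|) (fun _ _ => abs_nonneg _)
      (Finset.mem_univ j)).trans
    (Finset.single_le_sum (f := fun i => ∑ j, |Ψ r i j|)
      (fun _ _ => Finset.sum_nonneg fun _ _ => abs_nonneg _) (Finset.mem_univ k))
  have hmul : ∀ r i j, ‖(A r * Ψ r) i j‖ ≤ (n * |C|) * ∑ i, ∑ j, |Ψ r i j| := fun r i j => by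
    rw [Matrix.mul_apply, Real.norm_eq_abs]
    calc |∑ k, A r i k * Ψ r k j| ≤ ∑ k, |A r i k * Ψ r k j| := Finset.abs_sum_le_sum_abs _ _
      _ ≤ ∑ _k : Fin n, |C| * ∑ i, ∑ j, |Ψ r i j| := by
        refine Finset.sum_le_sum fun k _ => ?_
        rw [abs_mul]
        exact mul_le_mul ((hC r i k).trans (le_abs_self C)) (hentry r k j) (abs_nonneg _)
          (abs_nonneg _)
      _ = _ := by simp [mul_assoc]
  have hbound : ∀ t i j, |Ψ t i j| ≤ (n * |C|) * |∫ r in s..t, (∑ i, ∑ j, |Ψ r i j|)| :=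
    fun t i j => by
    rw [heq t i j, ← Real.norm_eq_abs]
    refine (intervalIntegral.norm_integral_le_abs_of_norm_le
      (Filter.Eventually.of_forall fun r => hmul r i j)
      ((hg.const_mul _).intervalIntegrable _ _)).trans ?_
    rw [intervalIntegral.integral_const_mul, abs_mul, abs_of_nonneg (by positivity)]
  have hzero := eq_zero_of_le_mul_abs_integral hg
    (fun t => Finset.sum_nonneg fun _ _ => Finset.sum_nonneg fun _ _ => abs_nonneg _)
    (K := n * (n * (n * |C|))) (s := s)
    (fun t => by
      refine (Finset.sum_le_sum fun i _ => Finset.sum_le_sum fun j _ => hbound t i j).trans ?_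
      simp [mul_assoc]) t
  ext i j
  exact abs_eq_zero.1 (le_antisymm ((hentry t i j).trans hzero.le) (abs_nonneg _))

/-- Entries of `A * Y` are interval integrable for `A` bounded measurable and `Y` continuous. -/
theorem intervalIntegrable_mul_apply (hAmeas : ∀ i j, Measurable fun t => A t i j)
    (hAbdd : ∃ C : ℝ, ∀ t i j, |A t i j| ≤ C)
    {Y : ℝ → Matrix (Fin n) (Fin n) ℝ} (hY : ∀ i j, Continuous fun t => Y t i j)
    (i j : Fin n) (a b : ℝ) :
    IntervalIntegrable (fun r => (A r * Y r) i j) volume a b := by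
  obtain ⟨C, hC⟩ := hAbdd
  simp only [Matrix.mul_apply]
  refine intervalIntegrable_sum_apply fun k => IntervalIntegrable.mul_continuousOn ?_
    (hY k j).continuousOn
  exact (intervalIntegrable_const (c := C)).mono_fun (hAmeas i k).aestronglyMeasurable
    (Filter.Eventually.of_forall fun r => (hC r i k).trans (le_abs_self C))

/-- Cocycle identity for the fundamental matrix. -/
theorem fundamental_matrix_mul
    (hAmeas : ∀ i j, Measurable fun t => A t i j)
    (hAbdd : ∃ C : ℝ, ∀ t i j, |A t i j| ≤ C)
    {Φ : ℝ → ℝ → Matrix (Fin n) (Fin n) ℝ}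
    (hΦcont : ∀ s i j, Continuous fun t => Φ t s i j)
    (hΦeq : ∀ s t i j, Φ t s i j
        = (1 : Matrix (Fin n) (Fin n) ℝ) i j + ∫ r in s..t, (A r * Φ r s) i j)
    (t s u : ℝ) : Φ t s * Φ s u = Φ t u := by
  have hint : ∀ v i j a b, IntervalIntegrable (fun r => (A r * Φ r v) i j) volume a b :=
    fun v => intervalIntegrable_mul_apply hAmeas hAbdd (hΦcont v)
  refine sub_eq_zero.1 (eq_zero_of_eq_integral_mul (Ψ := fun t => Φ t s * Φ s u - Φ t u) (s := s)
    hAbdd (fun i j => ?_) (fun t i j => ?_) t)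
  · simp only [Matrix.sub_apply, Matrix.mul_apply]
    fun_prop
  · have hleft : (Φ t s * Φ s u) i j = Φ s u i j + ∫ r in s..t, (A r * Φ r s * Φ s u) i j := by
      simp only [Matrix.mul_apply (M := A _ * Φ _ s)]
      rw [intervalIntegral.integral_finsetSum fun k _ => (hint s i k s t).mul_const _]
      simp only [intervalIntegral.integral_mul_const]
      rw [Matrix.mul_apply]
      simp only [hΦeq s t, add_mul, Finset.sum_add_distrib, ← Matrix.mul_apply, one_mul]
    have hright : Φ t u i j = Φ s u i j + ∫ r in s..t, (A r * Φ r u) i j := by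
      rw [hΦeq u t, hΦeq u s, add_assoc,
        intervalIntegral.integral_add_adjacent_intervals (hint u i j u s) (hint u i j s t)]
    have hmulint : IntervalIntegrable (fun r => (A r * Φ r s * Φ s u) i j) volume s t := by
      simp only [Matrix.mul_apply (M := A _ * Φ _ s)]
      exact intervalIntegrable_sum_apply fun k => (hint s i k s t).mul_const _
    simp only [mul_sub, ← mul_assoc, Matrix.sub_apply]
    rw [intervalIntegral.integral_sub hmulint (hint u i j s t), hleft, hright]
    ring

end LinearEquation

/-- The fundamental matrix `Φ_A(t, s)` associated with a measurable bounded `A` is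
invertible for all `t, s`, with inverse `Φ_A(s, t)`. -/
theorem fundamental_matrix_invertible
    (n : ℕ)
    (A : ℝ → Matrix (Fin n) (Fin n) ℝ)
    (hAmeas : ∀ i j, Measurable fun t => A t i j)
    (hAbdd : ∃ C : ℝ, ∀ t i j, |A t i j| ≤ C)
    (Φ : ℝ → ℝ → Matrix (Fin n) (Fin n) ℝ)
    (hΦcont : ∀ s i j, Continuous fun t => Φ t s i j)
    (hΦeq : ∀ s t i j, Φ t s i j
        = (1 : Matrix (Fin n) (Fin n) ℝ) i j + ∫ r in s..t, (A r * Φ r s) i j) :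
    ∀ t s : ℝ, IsUnit (Φ t s) ∧ Φ t s * Φ s t = 1 ∧ Φ s t * Φ t s = 1 := by
  have hdiag : ∀ t, Φ t t = 1 := fun t => by
    ext i j
    simp [hΦeq t t]
  have hinv : ∀ t s, Φ t s * Φ s t = 1 := fun t s =>
    (fundamental_matrix_mul hAmeas hAbdd hΦcont hΦeq t s t).trans (hdiag t)
  exact fun t s => ⟨⟨⟨Φ t s, Φ s t, hinv t s, hinv s t⟩, rfl⟩, hinv t s, hinv s t⟩
end

section
/- Relation between the delayed state and its Artstein transform: let A : ℝ → Matrix (Fin n) (Fin n) ℝ and B : ℝ → Matrix (Fin n) (Fin m) ℝ be measurable and bounded, let h > 0, T > h, let f : ℝ → ℝⁿ be measurable and integrable on [0, T], and let u : ℝ → ℝᵐ be measurable, square integrable on [−h, T], with u(s) = 0 for s ∈ [−h, 0). Suppose x : [0, T] → ℝⁿ is continuous and satisfies x(t) = x(0) + ∫_{0}^{t} (A(s) x(s) + B(s) u(s − h) + f(s)) ds for all t ∈ [0, T], and let y(t) := x(t) + ∫_{t−h}^{t} Φ_A(t, s + h) B(s + h) u(s) ds be its Artstein transform. Then for all t ∈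 [h, T], x(t) = Φ_A(t, t − h) y(t − h) + ∫_{t−h}^{t} Φ_A(t, s) f(s) ds. -/
open MeasureTheory

section LinearVolterra

open Set intervalIntegral

/-- Integration by parts for functions given as indefinite integrals of integrable functions. -/
lemma mul_eq_add_integral_of_eq_add_integral {F G f g : ℝ → ℝ} {a b : ℝ} (hab : a ≤ b)
    (hf : IntervalIntegrable f volume a b) (hg : IntervalIntegrable g volume a b)
    (hF : ∀ t ∈ Icc a b, F t = F a + ∫ s in a..t, f s)
    (hG : ∀ t ∈ Icc a b, G t = G a + ∫ s in a..t, g s) :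
    F b * G b = F a * G a + ∫ s in a..b, (f s * G s + F s * g s) := by
  have key : ∀ {p : ℝ → ℝ} (k : ℝ), IntervalIntegrable p volume a b →
      AbsolutelyContinuousOnInterval (fun t => k + ∫ s in a..t, p s) a b ∧
      ∀ᵐ t, t ∈ uIcc a b → deriv (fun t => k + ∫ s in a..t, p s) t = p t := by
    intro p k hp
    refine ⟨?_, ?_⟩
    · have h1 : AbsolutelyContinuousOnInterval (fun _ : ℝ => k) a b :=
        (LipschitzWith.const k).lipschitzOnWith.absolutelyContinuousOnInterval
      exact h1.add (hp.absolutelyContinuousOnInterval_intervalIntegral left_mem_uIcc)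
    · filter_upwards [hp.ae_hasDerivAt_integral] with t ht hmem
      exact ((ht hmem a left_mem_uIcc).const_add k).deriv
  obtain ⟨hF1, hF2⟩ := key (F a) hf
  obtain ⟨hG1, hG2⟩ := key (G a) hg
  have h := hF1.integral_deriv_mul_eq_sub hG1
  simp only [integral_same, add_zero] at h
  rw [← hF b (right_mem_Icc.2 hab), ← hG b (right_mem_Icc.2 hab)] at h
  rw [← sub_eq_iff_eq_add', ← h]
  refine integral_congr_ae ?_
  filter_upwards [hF2, hG2] with t h1 h2 ht
  have ht' := uIoc_subset_uIcc ht
  rw [h1 ht', h2 ht', hF t (uIcc_of_le hab ▸ ht'), hG t (uIcc_of_le hab ▸ ht')]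

lemma intervalIntegrable_mulVec_apply_of_mul {p q : ℕ} {M : ℝ → Matrix (Fin p) (Fin q) ℝ}
    {v : ℝ → Fin q → ℝ} {a b : ℝ} {i : Fin p}
    (hMv : ∀ j, IntervalIntegrable (fun t => M t i j * v t j) volume a b) :
    IntervalIntegrable (fun t => (M t).mulVec (v t) i) volume a b := by
  have := IntervalIntegrable.sum Finset.univ fun j _ => hMv j
  simpa only [Finset.sum_fn, Matrix.mulVec, dotProduct] using this

lemma intervalIntegrable_mulVec_apply {p q : ℕ} {A : ℝ → Matrix (Fin p) (Fin q) ℝ}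
    {v : ℝ → Fin q → ℝ} {a b : ℝ} (hA : ∀ i j, Measurable fun t => A t i j)
    (hAb : ∃ C : ℝ, ∀ t i j, |A t i j| ≤ C)
    (hv : ∀ j, IntervalIntegrable (fun t => v t j) volume a b) (i : Fin p) :
    IntervalIntegrable (fun t => (A t).mulVec (v t) i) volume a b := by
  obtain ⟨C, hC⟩ := hAb
  refine intervalIntegrable_mulVec_apply_of_mul fun j => ?_
  rw [intervalIntegrable_iff]
  exact Integrable.bdd_mul (c := C) (intervalIntegrable_iff.1 (hv j))
    (hA i j).aestronglyMeasurable (.of_forall fun t => hC t i j)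

/-- A continuous solution of a homogeneous linear Volterra equation with zero initial value
vanishes. -/
lemma eq_zero_of_eq_integral_mulVec {n : ℕ} {A : ℝ → Matrix (Fin n) (Fin n) ℝ}
    (hAb : ∃ C : ℝ, ∀ t i j, |A t i j| ≤ C) {a b : ℝ} {d : ℝ → Fin n → ℝ}
    (hdc : ∀ i, ContinuousOn (fun t => d t i) (Icc a b))
    (hd : ∀ t ∈ Icc a b, ∀ i, d t i = ∫ s in a..t, (A s).mulVec (d s) i) :
    ∀ t ∈ Icc a b, d t = 0 := by
  obtain ⟨C, hC⟩ := hAb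
  intro t₀ ht₀
  have hab : a ≤ b := ht₀.1.trans ht₀.2
  set φ : ℝ → ℝ := IccExtend hab (fun t : Icc a b => ∑ j, |d t j|) with hφ
  have hφc : Continuous φ := by
    refine Continuous.Icc_extend' ?_
    exact continuous_finsetSum _ fun j _ => (continuousOn_iff_continuous_domRestrict.1 (hdc j)).abs
  have hφe : ∀ t ∈ Icc a b, φ t = ∑ j, |d t j| := fun t ht => IccExtend_of_mem hab _ ht
  have hbound : ∀ t ∈ Icc a b, φ t ≤ (n * C) * ∫ s in a..t, φ s := by
    intro t ht
    have hi : ∀ i, |d t i| ≤ C * ∫ s in a..t, φ s := by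
      intro i
      rw [hd t ht i, ← intervalIntegral.integral_const_mul, ← Real.norm_eq_abs]
      refine norm_integral_le_of_norm_le ht.1 (.of_forall fun s hs => ?_)
        ((hφc.const_mul C).intervalIntegrable _ _)
      rw [hφe s ⟨hs.1.le, hs.2.trans ht.2⟩, Finset.mul_sum, Real.norm_eq_abs]
      simp only [Matrix.mulVec, dotProduct]
      refine (Finset.abs_sum_le_sum_abs _ _).trans (Finset.sum_le_sum fun j _ => ?_)
      rw [abs_mul]
      exact mul_le_mul_of_nonneg_right (hC s i j) (abs_nonneg _)
    calc φ t = ∑ j, |d t j| := hφe t ht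
      _ ≤ ∑ _j : Fin n, C * ∫ s in a..t, φ s := Finset.sum_le_sum fun j _ => hi j
      _ = _ := by simp [mul_assoc]
  have hφ0 : ∀ t ∈ Icc a b, 0 ≤ φ t := fun t ht => by
    rw [hφe t ht]; exact Finset.sum_nonneg fun _ _ => abs_nonneg _
  have hG0 : ∫ s in a..t₀, φ s = 0 := by
    refine eq_zero_of_abs_deriv_le_mul_abs_self_of_eq_zero_right (f' := φ) (K := n * C)
      (f := fun t => ∫ s in a..t, φ s)
      (continuous_primitive (fun _ _ => hφc.intervalIntegrable _ _) a).continuousOn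
      (fun t _ => (hφc.integral_hasStrictDerivAt a t).hasDerivAt.hasDerivWithinAt)
      integral_same (fun t ht => ?_) t₀ ht₀
    have ht' : t ∈ Icc a b := Ico_subset_Icc_self ht
    have hnn : 0 ≤ ∫ s in a..t, φ s :=
      integral_nonneg ht.1 fun s hs => hφ0 s ⟨hs.1, hs.2.trans ht'.2⟩
    rw [Real.norm_of_nonneg (hφ0 t ht'), Real.norm_of_nonneg hnn]
    exact hbound t ht'
  have h0 : ∑ j, |d t₀ j| ≤ 0 := by
    have := hbound t₀ ht₀
    rwa [hG0, mul_zero, hφe t₀ ht₀] at this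
  ext j
  refine abs_nonpos_iff.1 (le_trans ?_ h0)
  exact Finset.single_le_sum (f := fun j => |d t₀ j|) (fun _ _ => abs_nonneg _) (Finset.mem_univ j)

/-- Variation of constants: if `M` is the fundamental matrix started at `a` and `c` is a primitive
of `c'`, then `M * c` is the only solution of the linear equation with forcing `M * c'` and initial
value `c a`. -/
lemma eq_mulVec_of_eq_add_integral {n : ℕ} {A : ℝ → Matrix (Fin n) (Fin n) ℝ}
    (hA : ∀ i j, Measurable fun t => A t i j) (hAb : ∃ C : ℝ, ∀ t i j, |A t i j| ≤ C) {a b : ℝ}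
    {M : ℝ → Matrix (Fin n) (Fin n) ℝ} (hMc : ∀ i j, Continuous fun t => M t i j)
    (hM : ∀ t i j, M t i j = (1 : Matrix (Fin n) (Fin n) ℝ) i j + ∫ r in a..t, (A r * M r) i j)
    {c c' x : ℝ → Fin n → ℝ} (hc' : ∀ j, IntervalIntegrable (fun t => c' t j) volume a b)
    (hc : ∀ t ∈ Icc a b, ∀ j, c t j = c a j + ∫ s in a..t, c' s j)
    (hxc : ∀ i, ContinuousOn (fun t => x t i) (Icc a b))
    (hx : ∀ t ∈ Icc a b, ∀ i, x t i
      = c a i + ∫ s in a..t, ((A s).mulVec (x s) i + (M s).mulVec (c' s) i)) :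
    ∀ t ∈ Icc a b, x t = (M t).mulVec (c t) := by
  intro t₀ ht₀
  have hab : a ≤ b := ht₀.1.trans ht₀.2
  have hsub : ∀ t ∈ Icc a b, uIcc a t ⊆ uIcc a b := fun t ht =>
    uIcc_subset_uIcc_left (uIcc_of_le hab ▸ ht)
  have hIsub : ∀ t ∈ Icc a b, uIcc a t ⊆ Icc a b := fun t ht => uIcc_of_le hab ▸ hsub t ht
  have hAM : ∀ i j t, IntervalIntegrable (fun s => (A s * M s) i j) volume a t := fun i j t =>
    intervalIntegrable_mulVec_apply (v := fun s k => M s k j) hA hAb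
      (fun k => (hMc k j).intervalIntegrable _ _) i
  have hMa : M a = 1 := by ext i j; simp [hM a i j]
  have hcc : ∀ j, ContinuousOn (fun t => c t j) (Icc a b) := fun j => by
    have := (continuousOn_primitive_interval (intervalIntegrable_iff_integrableOn_Icc_of_le hab
      |>.1 (hc' j) |>.mono_set (uIcc_of_le hab).le)).const_add (c a j)
    rw [uIcc_of_le hab] at this
    exact this.congr fun t ht => hc t ht j
  have hMcc : ∀ i, ContinuousOn (fun t => (M t).mulVec (c t) i) (Icc a b) := fun i =>
    continuousOn_finsetSum Finset.univ fun j _ =>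
      ContinuousOn.fun_mul (hMc i j).continuousOn (hcc j)
  have hAv : ∀ {v : ℝ → Fin n → ℝ}, (∀ i, ContinuousOn (fun t => v t i) (Icc a b)) →
      ∀ t ∈ Icc a b, ∀ i, IntervalIntegrable (fun s => (A s).mulVec (v s) i) volume a t :=
    fun hv t ht i => intervalIntegrable_mulVec_apply hA hAb
      (fun j => ((hv j).mono (hIsub t ht)).intervalIntegrable) i
  have hMc' : ∀ t ∈ Icc a b, ∀ i, IntervalIntegrable (fun s => (M s).mulVec (c' s) i) volume a t :=
    fun t ht i => intervalIntegrable_mulVec_apply_of_mul fun j =>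
      ((hc' j).mono_set (hsub t ht)).continuousOn_mul (hMc i j).continuousOn
  have hz : ∀ t ∈ Icc a b, ∀ i, (M t).mulVec (c t) i
      = c a i + ∫ s in a..t, ((A s).mulVec ((M s).mulVec (c s)) i + (M s).mulVec (c' s) i) := by
    intro t ht i
    have hterm : ∀ j, M t i j * c t j = (1 : Matrix (Fin n) (Fin n) ℝ) i j * c a j
        + ∫ s in a..t, ((A s * M s) i j * c s j + M s i j * c' s j) := fun j => by
      rw [← hMa]
      refine mul_eq_add_integral_of_eq_add_integral (F := fun t => M t i j) (G := fun t => c t j)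
        ht.1 (hAM i j t) ((hc' j).mono_set (hsub t ht)) (fun s _ => ?_)
        (fun s hs => hc s ⟨hs.1, hs.2.trans ht.2⟩ j)
      rw [hMa]; exact hM s i j
    have hint : ∀ j, IntervalIntegrable
        (fun s => (A s * M s) i j * c s j + M s i j * c' s j) volume a t := fun j =>
      ((hAM i j t).mul_continuousOn ((hcc j).mono (hIsub t ht))).add
        (((hc' j).mono_set (hsub t ht)).continuousOn_mul (hMc i j).continuousOn)
    calc (M t).mulVec (c t) i = ∑ j, M t i j * c t j := rfl
      _ = (1 : Matrix (Fin n) (Fin n) ℝ).mulVec (c a) i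
          + ∑ j, ∫ s in a..t, ((A s * M s) i j * c s j + M s i j * c' s j) := by
        simp only [hterm, Finset.sum_add_distrib]; rfl
      _ = _ := by
        rw [Matrix.one_mulVec, ← integral_finsetSum fun j _ => hint j]
        simp only [Matrix.mulVec_mulVec, Finset.sum_add_distrib]
        rfl
  have := eq_zero_of_eq_integral_mulVec hAb (a := a) (b := b)
    (d := fun t => x t - (M t).mulVec (c t)) (fun i => (hxc i).sub (hMcc i)) (fun t ht i => by
      simp only [Pi.sub_apply, Matrix.mulVec_sub]
      rw [hx t ht i, hz t ht i, integral_sub (hAv hxc t ht i) (hAv hMcc t ht i),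
        integral_add (hAv hxc t ht i) (hMc' t ht i), integral_add (hAv hMcc t ht i) (hMc' t ht i)]
      ring) t₀ ht₀
  exact sub_eq_zero.1 this

lemma intervalIntegral_pi_apply {n : ℕ} {v : ℝ → Fin n → ℝ} {a b : ℝ}
    (hv : ∀ j, IntervalIntegrable (fun t => v t j) volume a b) (j : Fin n) :
    (∫ s in a..b, v s) j = ∫ s in a..b, v s j := by
  simp only [intervalIntegral, Pi.sub_apply]
  rw [eval_integral fun i => (hv i).1, eval_integral fun i => (hv i).2]

lemma mulVec_intervalIntegral {p n : ℕ} (M : Matrix (Fin p) (Fin n) ℝ) {v : ℝ → Fin n → ℝ}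
    {a b : ℝ} (hv : ∀ j, IntervalIntegrable (fun t => v t j) volume a b) :
    M.mulVec (∫ s in a..b, v s) = ∫ s in a..b, M.mulVec (v s) := by
  have hint : ∀ i j, IntervalIntegrable (fun t => M i j * v t j) volume a b :=
    fun i j => (hv j).const_mul _
  ext i
  rw [intervalIntegral_pi_apply fun i => intervalIntegrable_mulVec_apply_of_mul (hint i)]
  simp only [Matrix.mulVec, dotProduct]
  rw [integral_finsetSum fun j _ => hint i j]
  simp only [intervalIntegral_pi_apply hv, intervalIntegral.integral_const_mul]

section Fundamental

variable {n : ℕ} {A : ℝ → Matrix (Fin n) (Fin n) ℝ} {Φ : ℝ → ℝ → Matrix (Fin n) (Fin n) ℝ}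

lemma fundamental_mul_fundamental (hA : ∀ i j, Measurable fun t => A t i j)
    (hAb : ∃ C : ℝ, ∀ t i j, |A t i j| ≤ C)
    (hΦc : ∀ s i j, Continuous fun t => Φ t s i j)
    (hΦ : ∀ s t i j, Φ t s i j
      = (1 : Matrix (Fin n) (Fin n) ℝ) i j + ∫ r in s..t, (A r * Φ r s) i j)
    {a t : ℝ} (hat : a ≤ t) (r : ℝ) : Φ t a * Φ a r = Φ t r := by
  have hint : ∀ i j s t, IntervalIntegrable (fun s => (A s * Φ s r) i j) volume s t :=
    fun i j s t => intervalIntegrable_mulVec_apply (v := fun s k => Φ s r k j) hA hAb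
      (fun k => (hΦc r k j).intervalIntegrable _ _) i
  ext i j
  refine (congrFun (eq_mulVec_of_eq_add_integral hA hAb (a := a) (b := t) (hΦc a) (hΦ a)
    (c := fun _ k => Φ a r k j) (c' := 0) (x := fun s k => Φ s r k j) (fun _ => by simp)
    (fun _ _ _ => by simp) (fun i => (hΦc r i j).continuousOn) (fun s _ i => ?_) t
    (right_mem_Icc.2 hat)) i).symm
  simp only [Pi.zero_apply, Matrix.mulVec_zero, add_zero]
  rw [hΦ r s i j, hΦ r a i j, add_assoc,
    ← integral_add_adjacent_intervals (hint i j r a) (hint i j a s)]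
  rfl

lemma fundamental_mul_fundamental_self (hA : ∀ i j, Measurable fun t => A t i j)
    (hAb : ∃ C : ℝ, ∀ t i j, |A t i j| ≤ C)
    (hΦc : ∀ s i j, Continuous fun t => Φ t s i j)
    (hΦ : ∀ s t i j, Φ t s i j
      = (1 : Matrix (Fin n) (Fin n) ℝ) i j + ∫ r in s..t, (A r * Φ r s) i j)
    {a s : ℝ} (has : a ≤ s) : Φ s a * Φ a s = 1 := by
  rw [fundamental_mul_fundamental hA hAb hΦc hΦ has]
  ext i j
  simp [hΦ s s i j]

lemma continuousOn_fundamental_right (hA : ∀ i j, Measurable fun t => A t i j)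
    (hAb : ∃ C : ℝ, ∀ t i j, |A t i j| ≤ C)
    (hΦc : ∀ s i j, Continuous fun t => Φ t s i j)
    (hΦ : ∀ s t i j, Φ t s i j
      = (1 : Matrix (Fin n) (Fin n) ℝ) i j + ∫ r in s..t, (A r * Φ r s) i j)
    {a t : ℝ} (hat : a ≤ t) (i j : Fin n) : ContinuousOn (fun s => Φ t s i j) (Ici a) := by
  have hinv : ∀ s ∈ Ici a, Φ s a * Φ a s = 1 := fun s hs =>
    fundamental_mul_fundamental_self hA hAb hΦc hΦ hs
  have hcont : Continuous fun s => Φ s a := continuous_matrix fun i j => hΦc a i j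
  have hdet : ∀ s ∈ Ici a, (Φ s a).det ≠ 0 := fun s hs h0 => by
    simpa [h0] using congrArg Matrix.det (hinv s hs)
  have hadj : ContinuousOn (fun s => Φ t a * ((Φ s a).det⁻¹ • (Φ s a).adjugate)) (Ici a) :=
    continuousOn_const.mul ((hcont.matrix_det.continuousOn.inv₀ hdet).smul
      hcont.matrix_adjugate.continuousOn)
  refine ((continuous_id.matrix_elem i j).comp_continuousOn hadj).congr fun s hs => ?_
  rw [← fundamental_mul_fundamental hA hAb hΦc hΦ hat s,
    ← Matrix.inv_eq_right_inv (hinv s hs), Matrix.inv_def, Ring.inverse_eq_inv]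
  rfl

/-- The variation of constants formula for a linear Volterra equation with integrable forcing. -/
lemma eq_fundamental_mulVec_add_integral (hA : ∀ i j, Measurable fun t => A t i j)
    (hAb : ∃ C : ℝ, ∀ t i j, |A t i j| ≤ C)
    (hΦc : ∀ s i j, Continuous fun t => Φ t s i j)
    (hΦ : ∀ s t i j, Φ t s i j
      = (1 : Matrix (Fin n) (Fin n) ℝ) i j + ∫ r in s..t, (A r * Φ r s) i j)
    {a b : ℝ} (hab : a ≤ b) {g x : ℝ → Fin n → ℝ}
    (hg : ∀ j, IntervalIntegrable (fun t => g t j) volume a b)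
    (hxc : ∀ i, ContinuousOn (fun t => x t i) (Icc a b))
    (hx : ∀ t ∈ Icc a b, ∀ i, x t i = x a i + ∫ s in a..t, ((A s).mulVec (x s) i + g s i)) :
    x b = (Φ b a).mulVec (x a) + ∫ s in a..b, (Φ b s).mulVec (g s) := by
  have hc' : ∀ j, IntervalIntegrable (fun s => (Φ a s).mulVec (g s) j) volume a b := fun j =>
    intervalIntegrable_mulVec_apply_of_mul fun k => (hg k).continuousOn_mul
      ((continuousOn_fundamental_right hA hAb hΦc hΦ le_rfl j k).mono
        ((uIcc_of_le hab).le.trans Icc_subset_Ici_self))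
  have key := eq_mulVec_of_eq_add_integral hA hAb (hΦc a) (hΦ a) hc'
    (c := fun t j => x a j + ∫ s in a..t, (Φ a s).mulVec (g s) j) (fun t _ j => by simp) hxc
    (fun t ht i => by
      simp only [integral_same, add_zero]
      rw [hx t ht i]
      congr 1
      refine integral_congr fun s hs => ?_
      rw [uIcc_of_le ht.1] at hs
      simp only [Matrix.mulVec_mulVec,
        fundamental_mul_fundamental_self hA hAb hΦc hΦ hs.1, Matrix.one_mulVec]) b
    (right_mem_Icc.2 hab)
  have hsplit : (fun j => x a j + ∫ s in a..b, (Φ a s).mulVec (g s) j)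
      = x a + ∫ s in a..b, (Φ a s).mulVec (g s) := by
    ext j; simp only [Pi.add_apply, intervalIntegral_pi_apply hc']
  rw [key, hsplit, Matrix.mulVec_add, mulVec_intervalIntegral _ hc']
  simp only [Matrix.mulVec_mulVec, fundamental_mul_fundamental hA hAb hΦc hΦ hab]

end Fundamental

end LinearVolterra

open MeasureTheory

/-- Relation between the delayed state `x` and its Artstein transform `y`:
for all `t ∈ [h, T]`, `x(t) = Φ_A(t, t-h) y(t-h) + ∫_{t-h}^{t} Φ_A(t, s) f(s) ds`. -/
theorem artstein_transform_state_relation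
    (n m : ℕ)
    (A : ℝ → Matrix (Fin n) (Fin n) ℝ)
    (hAmeas : ∀ i j, Measurable fun t => A t i j)
    (hAbdd : ∃ C : ℝ, ∀ t i j, |A t i j| ≤ C)
    (Φ : ℝ → ℝ → Matrix (Fin n) (Fin n) ℝ)
    (hΦcont : ∀ s i j, Continuous fun t => Φ t s i j)
    (hΦeq : ∀ s t i j, Φ t s i j
        = (1 : Matrix (Fin n) (Fin n) ℝ) i j + ∫ r in s..t, (A r * Φ r s) i j)
    (B : ℝ → Matrix (Fin n) (Fin m) ℝ)
    (hBmeas : ∀ i j, Measurable fun t => B t i j)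
    (hBbdd : ∃ C : ℝ, ∀ t i j, |B t i j| ≤ C)
    (h T : ℝ) (hh : 0 < h) (hT : h < T)
    (f : ℝ → Fin n → ℝ)
    (hfmeas : ∀ i, Measurable fun t => f t i)
    (hfint : ∀ i, IntervalIntegrable (fun t => f t i) volume 0 T)
    (u : ℝ → Fin m → ℝ)
    (humeas : ∀ i, Measurable fun t => u t i)
    (husq : IntegrableOn (fun t => ∑ i, (u t i) ^ 2) (Set.Icc (-h) T))
    (huzero : ∀ s ∈ Set.Ico (-h) (0 : ℝ), u s = 0)
    (x : ℝ → Fin n → ℝ)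
    (hxcont : ∀ i, ContinuousOn (fun t => x t i) (Set.Icc 0 T))
    (hx : ∀ t ∈ Set.Icc (0 : ℝ) T,
      x t = x 0 + ∫ s in (0 : ℝ)..t, ((A s).mulVec (x s) + (B s).mulVec (u (s - h)) + f s))
    (y : ℝ → Fin n → ℝ)
    (hy : ∀ t, y t = x t + ∫ s in (t - h)..t, (Φ t (s + h)).mulVec ((B (s + h)).mulVec (u s))) :
    ∀ t ∈ Set.Icc h T,
      x t = (Φ t (t - h)).mulVec (y (t - h)) + ∫ s in (t - h)..t, (Φ t s).mulVec (f s) := by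
  intro t ht
  obtain ⟨ht1, ht2⟩ := ht
  have hu : ∀ i, IntervalIntegrable (fun s => u s i) volume (-h) T := fun i => by
    rw [intervalIntegrable_iff_integrableOn_Icc_of_le (by linarith)]
    have hm : AEStronglyMeasurable (fun s => u s i) (volume.restrict (Set.Icc (-h) T)) :=
      (humeas i).aestronglyMeasurable
    refine MemLp.integrable (q := 2) (by norm_num) ((memLp_two_iff_integrable_sq hm).2 ?_)
    refine Integrable.mono' husq (hm.pow 2) (.of_forall fun s => ?_)
    rw [Real.norm_of_nonneg (sq_nonneg _)]
    exact Finset.single_le_sum (f := fun i => u s i ^ 2) (fun _ _ => sq_nonneg _)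
      (Finset.mem_univ i)
  have hu' : ∀ i, IntervalIntegrable (fun s => u (s - h) i) volume 0 T := fun i =>
    ((hu i).comp_sub_right h).mono_set (by
      rw [Set.uIcc_of_le (by linarith), Set.uIcc_of_le (by linarith)]
      exact Set.Icc_subset_Icc (by linarith) (by linarith))
  have hBu : ∀ i, IntervalIntegrable (fun s => (B s).mulVec (u (s - h)) i) volume 0 T :=
    intervalIntegrable_mulVec_apply hBmeas hBbdd hu'
  have hAx : ∀ i, IntervalIntegrable (fun s => (A s).mulVec (x s) i) volume 0 T :=
    intervalIntegrable_mulVec_apply hAmeas hAbdd fun j =>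
      ((hxcont j).mono (Set.uIcc_of_le (by linarith)).le).intervalIntegrable
  have hsub : ∀ {a b : ℝ}, a ∈ Set.Icc 0 T → b ∈ Set.Icc 0 T → Set.uIcc a b ⊆ Set.uIcc 0 T :=
    fun ha hb => by
      rw [Set.uIcc_of_le (show 0 ≤ T by linarith)]
      exact Set.uIcc_subset_Icc ha hb
  have hall : ∀ i, IntervalIntegrable
      (fun s => ((A s).mulVec (x s) + (B s).mulVec (u (s - h)) + f s) i) volume 0 T :=
    fun i => ((hAx i).add (hBu i)).add (hfint i)
  have ha : t - h ∈ Set.Icc 0 T := ⟨by linarith, by linarith⟩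
  have htm : t ∈ Set.Icc 0 T := ⟨by linarith, ht2⟩
  have h0 : (0 : ℝ) ∈ Set.Icc 0 T := ⟨le_rfl, by linarith⟩
  have hle : t - h ≤ t := by linarith
  have hxi : ∀ s ∈ Set.Icc 0 T, ∀ i, x s i = x 0 i + ∫ r in (0 : ℝ)..s,
      ((A r).mulVec (x r) + (B r).mulVec (u (r - h)) + f r) i := fun s hs i => by
    rw [← intervalIntegral_pi_apply fun j => (hall j).mono_set (hsub h0 hs)]
    exact congrFun (hx s hs) i
  have hvar := eq_fundamental_mulVec_add_integral hAmeas hAbdd hΦcont hΦeq hle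
    (g := fun s => (B s).mulVec (u (s - h)) + f s) (x := x)
    (fun j => ((hBu j).add (hfint j)).mono_set (hsub ha htm))
    (fun i => (hxcont i).mono (Set.Icc_subset_Icc ha.1 ht2))
    (fun s hs i => by
      have hs' : s ∈ Set.Icc 0 T := ⟨ha.1.trans hs.1, hs.2.trans ht2⟩
      rw [hxi s hs', hxi _ ha, add_assoc, ← intervalIntegral.integral_add_adjacent_intervals
        ((hall i).mono_set (hsub h0 ha)) ((hall i).mono_set (hsub ha hs'))]
      simp only [Pi.add_apply, add_assoc])
  have hΦint : ∀ {v : ℝ → Fin n → ℝ}, (∀ j, IntervalIntegrable (fun s => v s j) volume 0 T) →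
      ∀ i, IntervalIntegrable (fun s => (Φ t s).mulVec (v s) i) volume (t - h) t := fun hv i =>
    intervalIntegrable_mulVec_apply_of_mul fun j =>
      ((hv j).mono_set (hsub ha htm)).continuousOn_mul
        ((continuousOn_fundamental_right hAmeas hAbdd hΦcont hΦeq hle i j).mono
          ((Set.uIcc_of_le hle).le.trans Set.Icc_subset_Ici_self))
  have hΦint' : ∀ i, IntervalIntegrable
      (fun s => (Φ (t - h) s).mulVec ((B s).mulVec (u (s - h))) i) volume (t - h) t := fun i =>
    intervalIntegrable_mulVec_apply_of_mul fun j =>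
      ((hBu j).mono_set (hsub ha htm)).continuousOn_mul
        ((continuousOn_fundamental_right hAmeas hAbdd hΦcont hΦeq le_rfl i j).mono
          ((Set.uIcc_of_le hle).le.trans Set.Icc_subset_Ici_self))
  have hshift : ∫ s in (t - h - h)..(t - h),
        (Φ (t - h) (s + h)).mulVec ((B (s + h)).mulVec (u s))
      = ∫ s in (t - h)..t, (Φ (t - h) s).mulVec ((B s).mulVec (u (s - h))) := by
    have := intervalIntegral.integral_comp_add_right (a := t - h - h) (b := t - h)
      (fun s => (Φ (t - h) s).mulVec ((B s).mulVec (u (s - h)))) h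
    simpa only [add_sub_cancel_right, sub_add_cancel] using this
  rw [hvar, hy, hshift, Matrix.mulVec_add, mulVec_intervalIntegral _ hΦint', add_assoc]
  have hcomp : ∀ s (v : Fin n → ℝ),
      (Φ t (t - h)).mulVec ((Φ (t - h) s).mulVec v) = (Φ t s).mulVec v := fun s v => by
    rw [Matrix.mulVec_mulVec, fundamental_mul_fundamental hAmeas hAbdd hΦcont hΦeq hle]
  simp only [hcomp]
  congr 1
  ext i
  simp only [Pi.add_apply]
  rw [intervalIntegral_pi_apply (hΦint hBu), intervalIntegral_pi_apply (hΦint hfint),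
    ← intervalIntegral.integral_add (hΦint hBu i) (hΦint hfint i), intervalIntegral_pi_apply]
  · simp only [Matrix.mulVec_add, Pi.add_apply]
  · exact hΦint fun j => (hBu j).add (hfint j)
end

section
/- Properties of the controllability Grammian: let A : ℝ → Matrix (Fin n) (Fin n) ℝ and B : ℝ → Matrix (Fin n) (Fin m) ℝ be measurable and bounded, let Φ_A be the fundamental matrix of A, let τ < T, and define the Grammian G_τ^T := ∫_{τ}^{T} Φ_A(T, s) B(s) B(s)ᵀ Φ_A(T, s)ᵀ ds. Then: (i) G_τ^T is symmetric positive semidefinite; (ii) G_τ^T is invertible if and only if it is positive definite, which holds if and only if for every nonzero x ∈ ℝⁿ the function s ↦ B(s)ᵀ Φ_A(T, s)ᵀ x is not almost-everywhere zero on [τ, T]. -/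
open MeasureTheory Matrix

/-- Integral Grönwall inequality with zero initial value. -/
theorem eq_zero_of_le_mul_intervalIntegral {d : ℝ → ℝ} {K a : ℝ} (hd : Continuous d)
    (hd0 : ∀ t, 0 ≤ d t) (hle : ∀ t, a ≤ t → d t ≤ K * ∫ r in a..t, d r) {t : ℝ} (ht : a ≤ t) :
    d t = 0 := by
  have hderiv : ∀ x, HasDerivAt (fun u => ∫ r in a..u, d r) (d x) x := fun x =>
    intervalIntegral.integral_hasDerivAt_right (hd.intervalIntegrable _ _)
      (hd.stronglyMeasurableAtFilter _ _) hd.continuousAt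
  have hu := eq_zero_of_abs_deriv_le_mul_abs_self_of_eq_zero_right (K := K) (b := t)
    (fun x _ => (hderiv x).continuousAt.continuousWithinAt)
    (fun x _ => (hderiv x).hasDerivWithinAt) (intervalIntegral.integral_same) (fun x hx => by
      rw [Real.norm_of_nonneg (hd0 x), Real.norm_of_nonneg
        (intervalIntegral.integral_nonneg hx.1 fun r _ => hd0 r)]
      exact hle x hx.1) t ⟨ht, le_rfl⟩
  have := hle t ht
  simp only [hu, mul_zero] at this
  exact le_antisymm this (hd0 t)

theorem intervalIntegrable_bounded_mul_continuous {f g : ℝ → ℝ} (hf : Measurable f) {C : ℝ}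
    (hC : ∀ t, |f t| ≤ C) (hg : Continuous g) (a b : ℝ) :
    IntervalIntegrable (fun t => f t * g t) volume a b := by
  rw [intervalIntegrable_iff]
  exact (intervalIntegrable_iff.1 (hg.intervalIntegrable a b)).bdd_mul
    hf.aestronglyMeasurable (Filter.Eventually.of_forall hC)

theorem intervalIntegrable_matrix_mul_apply {l m n : Type*} [Fintype m]
    {A : ℝ → Matrix l m ℝ} {X : ℝ → Matrix m n ℝ} (hA : ∀ i j, Measurable fun t => A t i j)
    {C : ℝ} (hC : ∀ t i j, |A t i j| ≤ C) (hX : ∀ i j, Continuous fun t => X t i j)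
    (a b : ℝ) (i : l) (j : n) :
    IntervalIntegrable (fun r => (A r * X r) i j) volume a b := by
  have := IntervalIntegrable.sum (μ := volume) (a := a) (b := b) Finset.univ (f := fun k r =>
    A r i k * X r k j) fun k _ => intervalIntegrable_bounded_mul_continuous (hA i k)
      (fun t => hC t i k) (hX k j) a b
  refine this.congr fun r _ => ?_
  simp [Matrix.mul_apply]

/-- Uniqueness, forward in time, for the homogeneous linear integral equation. -/
theorem eq_zero_of_linear_integral_equation {m n : Type*} [Fintype m] [Fintype n]
    {A : ℝ → Matrix m m ℝ} {X : ℝ → Matrix m n ℝ} {C : ℝ}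
    (hC : ∀ t i j, |A t i j| ≤ C) (hX : ∀ i j, Continuous fun t => X t i j) {a : ℝ}
    (heq : ∀ t i j, X t i j = ∫ r in a..t, (A r * X r) i j) {t : ℝ} (ht : a ≤ t) :
    X t = 0 := by
  let d : ℝ → ℝ := fun r => ∑ i, ∑ j, |X r i j|
  have hd : Continuous d := by
    simp only [d]
    fun_prop
  have hd0 : ∀ r, 0 ≤ d r := fun r => by positivity
  have hentry : ∀ r i j, |(A r * X r) i j| ≤ C * d r := fun r i j => by
    have hC0 : 0 ≤ C := (abs_nonneg _).trans (hC r i i)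
    calc |(A r * X r) i j| ≤ ∑ k, |A r i k * X r k j| := by
          rw [Matrix.mul_apply]
          exact Finset.abs_sum_le_sum_abs _ _
      _ ≤ ∑ k, C * ∑ j, |X r k j| := Finset.sum_le_sum fun k _ => by
          rw [abs_mul]
          exact mul_le_mul (hC r i k) (Finset.single_le_sum (f := fun j => |X r k j|)
            (fun j _ => abs_nonneg _) (Finset.mem_univ j)) (abs_nonneg _) hC0
      _ = C * d r := by rw [Finset.mul_sum]
  have hle : ∀ u, a ≤ u → d u ≤ (Fintype.card m * (Fintype.card n * C)) * ∫ r in a..u, d r := by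
    intro u hu
    calc d u ≤ ∑ _i : m, ∑ _j : n, C * ∫ r in a..u, d r := by
          refine Finset.sum_le_sum fun i _ => Finset.sum_le_sum fun j _ => ?_
          rw [heq u i j, ← intervalIntegral.integral_const_mul]
          exact intervalIntegral.norm_integral_le_of_norm_le (f := fun r => (A r * X r) i j) hu
            (Filter.Eventually.of_forall fun r _ => hentry r i j)
            ((hd.const_mul C).intervalIntegrable _ _)
      _ = _ := by
          simp only [Finset.sum_const, Finset.card_univ, nsmul_eq_mul]
          ring
  have h0 : d t = 0 := eq_zero_of_le_mul_intervalIntegral hd hd0 hle ht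
  ext i j
  have h1 := (Finset.sum_eq_zero_iff_of_nonneg (fun i _ => by positivity)).1 h0 i
    (Finset.mem_univ i)
  exact abs_eq_zero.1 ((Finset.sum_eq_zero_iff_of_nonneg (fun j _ => abs_nonneg _)).1 h1 j
    (Finset.mem_univ j))

section FundamentalMatrix

variable {n : Type*} [Fintype n] [DecidableEq n] {A : ℝ → Matrix n n ℝ}
  {Φ : ℝ → ℝ → Matrix n n ℝ} {C : ℝ}

theorem fundamentalMatrix_mul_eq_one (hA : ∀ i j, Measurable fun t => A t i j)
    (hC : ∀ t i j, |A t i j| ≤ C) (hΦ : ∀ s i j, Continuous fun t => Φ t s i j)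
    (heq : ∀ s t i j, Φ t s i j
      = (1 : Matrix n n ℝ) i j + ∫ r in s..t, (A r * Φ r s) i j) {s t : ℝ} (hst : s ≤ t) :
    Φ t s * Φ s t = 1 := by
  have hprod : ∀ i j, Continuous fun r => (Φ r s * Φ s t) i j := fun i j => by
    simp only [Matrix.mul_apply]
    fun_prop
  have hself : ∀ s, Φ s s = 1 := fun s => by
    ext i j
    simp [heq s s i j]
  have hX := eq_zero_of_linear_integral_equation (X := fun r => Φ r s * Φ s t - Φ r t) hC
    (fun i j => (hprod i j).sub (hΦ t i j)) (a := s) (fun u i j => by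
      have h1 : Φ u t i j = Φ s t i j + ∫ r in s..u, (A r * Φ r t) i j := by
        have hint := intervalIntegrable_matrix_mul_apply hA hC (hΦ t)
        rw [heq t u i j, heq t s i j, add_assoc,
          intervalIntegral.integral_add_adjacent_intervals (hint _ _ i j) (hint _ _ i j)]
      have h2 : (Φ u s * Φ s t) i j
          = Φ s t i j + ∫ r in s..u, (A r * (Φ r s * Φ s t)) i j := by
        have hfun : ∀ r, (A r * (Φ r s * Φ s t)) i j
            = ∑ k, (A r * Φ r s) i k * Φ s t k j := fun r => by
          rw [← Matrix.mul_assoc, Matrix.mul_apply]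
        simp only [hfun]
        rw [intervalIntegral.integral_finsetSum fun k _ =>
          (intervalIntegrable_matrix_mul_apply hA hC (hΦ s) s u i k).mul_const _]
        simp only [intervalIntegral.integral_mul_const]
        rw [Matrix.mul_apply]
        simp only [heq s u, add_mul, Finset.sum_add_distrib]
        rw [← Matrix.mul_apply, Matrix.one_mul]
      simp only [Matrix.mul_sub, Matrix.sub_apply]
      rw [intervalIntegral.integral_sub (intervalIntegrable_matrix_mul_apply hA hC hprod s u i j)
        (intervalIntegrable_matrix_mul_apply hA hC (hΦ t) s u i j), h1, h2]
      ring) hst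
  rw [hself t] at hX
  exact sub_eq_zero.1 hX

theorem continuousOn_fundamentalMatrix_initialTime (hA : ∀ i j, Measurable fun t => A t i j)
    (hC : ∀ t i j, |A t i j| ≤ C) (hΦ : ∀ s i j, Continuous fun t => Φ t s i j)
    (heq : ∀ s t i j, Φ t s i j
      = (1 : Matrix n n ℝ) i j + ∫ r in s..t, (A r * Φ r s) i j) (T : ℝ) :
    ContinuousOn (Φ T) (Set.Iic T) := by
  have hinv : ∀ s ∈ Set.Iic T, Φ T s = (Φ s T)⁻¹ := fun s hs =>
    (Matrix.inv_eq_left_inv (fundamentalMatrix_mul_eq_one hA hC hΦ heq hs)).symm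
  refine ContinuousOn.congr (fun s hs => ?_) hinv
  have hdet : (Φ s T).det ≠ 0 :=
    (Matrix.isUnit_det_of_left_inverse
      (fundamentalMatrix_mul_eq_one hA hC hΦ heq hs)).ne_zero
  refine (ContinuousAt.comp (f := fun s => Φ s T) (continuousAt_matrix_inv _ ?_)
    (continuous_matrix (hΦ T)).continuousAt).continuousWithinAt
  rw [Ring.inverse_eq_inv']
  exact continuousAt_inv₀ hdet

end FundamentalMatrix

theorem memLp_top_matrix_mul_apply {α l m n : Type*} [Fintype m] [MeasurableSpace α]
    {μ : Measure α} {X : α → Matrix l m ℝ} {Y : α → Matrix m n ℝ}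
    (hX : ∀ i j, MemLp (fun a => X a i j) ⊤ μ) (hY : ∀ i j, MemLp (fun a => Y a i j) ⊤ μ)
    (i : l) (j : n) : MemLp (fun a => (X a * Y a) i j) ⊤ μ := by
  simp only [Matrix.mul_apply]
  exact memLp_finsetSum _ fun k _ => (hY k j).mul (hX i k)

theorem dotProduct_mulVec_eq_integral {α n : Type*} [Fintype n] [MeasurableSpace α]
    {μ : Measure α} {M : α → Matrix n n ℝ} (hM : ∀ i j, Integrable (fun a => M a i j) μ)
    {G : Matrix n n ℝ} (hG : ∀ i j, G i j = ∫ a, M a i j ∂μ) (x : n → ℝ) :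
    Integrable (fun a => x ⬝ᵥ M a *ᵥ x) μ ∧ x ⬝ᵥ G *ᵥ x = ∫ a, x ⬝ᵥ M a *ᵥ x ∂μ := by
  have hint : ∀ i, Integrable (fun a => ∑ j, M a i j * x j) μ := fun i =>
    integrable_finsetSum _ fun j _ => (hM i j).mul_const _
  simp only [dotProduct, mulVec]
  refine ⟨integrable_finsetSum _ fun i _ => (hint i).const_mul _, ?_⟩
  rw [integral_finsetSum _ fun i _ => (hint i).const_mul _]
  refine Finset.sum_congr rfl fun i _ => ?_
  rw [integral_const_mul, integral_finsetSum _ fun j _ => (hM i j).mul_const _]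
  simp only [integral_mul_const, hG]

theorem dotProduct_mul_transpose_mulVec {l m n : Type*} [Fintype l] [Fintype m] [Fintype n]
    (P : Matrix l m ℝ) (Q : Matrix m n ℝ) (x : l → ℝ) :
    x ⬝ᵥ (P * Q * Qᵀ * Pᵀ) *ᵥ x = (Qᵀ *ᵥ (Pᵀ *ᵥ x)) ⬝ᵥ (Qᵀ *ᵥ (Pᵀ *ᵥ x)) := by
  rw [← Matrix.mulVec_mulVec, ← Matrix.mulVec_mulVec, Matrix.dotProduct_mulVec,
    ← Matrix.mulVec_transpose, Matrix.transpose_mul, Matrix.mulVec_mulVec]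


/-- Properties of the controllability Grammian
`G_τ^T = ∫_τ^T Φ_A(T,s) B(s) B(s)ᵀ Φ_A(T,s)ᵀ ds`:
(i) it is symmetric positive semidefinite; (ii) it is invertible iff it is positive
definite, which holds iff for every nonzero `x` the function `s ↦ B(s)ᵀ Φ_A(T,s)ᵀ x`
is not almost-everywhere zero on `[τ, T]`. -/
theorem grammian_posSemidef_and_invertibility
    (n m : ℕ)
    (A : ℝ → Matrix (Fin n) (Fin n) ℝ)
    (hAmeas : ∀ i j, Measurable fun t => A t i j)
    (hAbdd : ∃ C : ℝ, ∀ t i j, |A t i j| ≤ C)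
    (Φ : ℝ → ℝ → Matrix (Fin n) (Fin n) ℝ)
    (hΦcont : ∀ s i j, Continuous fun t => Φ t s i j)
    (hΦeq : ∀ s t i j, Φ t s i j
        = (1 : Matrix (Fin n) (Fin n) ℝ) i j + ∫ r in s..t, (A r * Φ r s) i j)
    (B : ℝ → Matrix (Fin n) (Fin m) ℝ)
    (hBmeas : ∀ i j, Measurable fun t => B t i j)
    (hBbdd : ∃ C : ℝ, ∀ t i j, |B t i j| ≤ C)
    (τ T : ℝ) (hτT : τ < T)
    (G : Matrix (Fin n) (Fin n) ℝ)
    (hG : ∀ i j, G i j = ∫ s in τ..T, (Φ T s * B s * (B s)ᵀ * (Φ T s)ᵀ) i j) :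
    G.PosSemidef ∧
    (IsUnit G ↔ G.PosDef) ∧
    (G.PosDef ↔ ∀ x : Fin n → ℝ, x ≠ 0 →
      ¬ (∀ᵐ s ∂(volume.restrict (Set.Icc τ T)),
          (B s)ᵀ.mulVec ((Φ T s)ᵀ.mulVec x) = 0)) := by
  obtain ⟨CA, hCA⟩ := hAbdd
  obtain ⟨CB, hCB⟩ := hBbdd
  let μ := volume.restrict (Set.Icc τ T)
  have hΦmem : ∀ i j, MemLp (fun s => Φ T s i j) ⊤ μ := fun i j => by
    have hcont : ContinuousOn (fun s => Φ T s i j) (Set.Icc τ T) :=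
      (continuous_id.matrix_elem i j).comp_continuousOn
        ((continuousOn_fundamentalMatrix_initialTime hAmeas hCA hΦcont hΦeq T).mono
          Set.Icc_subset_Iic_self)
    obtain ⟨K, hK⟩ := isCompact_Icc.exists_bound_of_continuousOn hcont
    exact memLp_top_of_bound (hcont.aestronglyMeasurable measurableSet_Icc) K
      ((ae_restrict_iff' measurableSet_Icc).2 (Filter.Eventually.of_forall hK))
  have hBmem : ∀ i j, MemLp (fun s => B s i j) ⊤ μ := fun i j =>
    memLp_top_of_bound (hBmeas i j).aestronglyMeasurable CB
      (Filter.Eventually.of_forall fun s => hCB s i j)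
  have hint : ∀ i j, Integrable (fun s => (Φ T s * B s * (B s)ᵀ * (Φ T s)ᵀ) i j) μ := fun i j =>
    (memLp_top_matrix_mul_apply (memLp_top_matrix_mul_apply
      (memLp_top_matrix_mul_apply hΦmem hBmem) fun i j => hBmem j i)
      (fun i j => hΦmem j i) i j).integrable le_top
  have hG' : ∀ i j, G i j = ∫ s, (Φ T s * B s * (B s)ᵀ * (Φ T s)ᵀ) i j ∂μ := fun i j => by
    rw [hG, intervalIntegral.integral_of_le hτT.le, integral_Icc_eq_integral_Ioc]
  have hquad := dotProduct_mulVec_eq_integral hint hG'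
  simp only [dotProduct_mul_transpose_mulVec] at hquad
  have hherm : G.IsHermitian := by
    ext i j
    simp only [conjTranspose_apply, star_trivial, hG]
    refine intervalIntegral.integral_congr fun s _ => ?_
    rw [← Matrix.transpose_apply (Φ T s * B s * (B s)ᵀ * (Φ T s)ᵀ)]
    simp only [transpose_mul, transpose_transpose, Matrix.mul_assoc]
  have hnonneg : ∀ v : Fin m → ℝ, 0 ≤ v ⬝ᵥ v := fun v =>
    Finset.sum_nonneg fun i _ => mul_self_nonneg _
  have hpsd : G.PosSemidef := .of_dotProduct_mulVec_nonneg hherm fun x => by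
    rw [star_trivial, (hquad x).2]
    exact integral_nonneg fun s => hnonneg _
  have hzero : ∀ x, x ⬝ᵥ G *ᵥ x = 0 ↔
      ∀ᵐ s ∂μ, (B s)ᵀ.mulVec ((Φ T s)ᵀ.mulVec x) = 0 := fun x => by
    rw [(hquad x).2, integral_eq_zero_iff_of_nonneg (fun s => hnonneg _) (hquad x).1]
    exact Filter.eventually_congr (Filter.Eventually.of_forall fun s => dotProduct_self_eq_zero)
  refine ⟨hpsd, hpsd.posDef_iff_isUnit.symm, fun h x hx h0 => ?_, fun h => ?_⟩
  · have hpos := h.dotProduct_mulVec_pos hx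
    rw [star_trivial, (hzero x).2 h0] at hpos
    exact lt_irrefl _ hpos
  · refine .of_dotProduct_mulVec_pos hherm fun x hx => ?_
    refine (hpsd.dotProduct_mulVec_nonneg x).lt_of_ne' fun h0 => h x hx ((hzero x).1 ?_)
    rwa [star_trivial] at h0
end

section
/- Grammian identity under the Artstein transformation: let A : ℝ → Matrix (Fin n) (Fin n) ℝ and B : ℝ → Matrix (Fin n) (Fin m) ℝ be measurable and bounded, let h > 0, and let Φ_A be the fundamental matrix of A. Define B̄(s) := Φ_A(s, s + h) B(s + h) and, for τ < T, the transformed Grammian Ḡ_τ^T := ∫_{τ}^{T} Φ_A(T, s) B̄(s) B̄(s)ᵀ Φ_A(T, s)ᵀ ds. Then Ḡ_τ^T = Φ_A(T, T + h) · (∫_{τ+h}^{T+h} Φ_A(T + h, σ) B(σ) B(σ)ᵀ Φ_A(T + h, σ)ᵀ dσ) · Φ_A(T, T + h)ᵀ. In particular, if the Grammian G_{τ+h}^{T+h} := ∫_{τ+h}^{T+h} Φ_A(T + h, σ) B(σ) B(σ)ᵀ Φ_A(T + h, σ)ᵀ dσ is invertible, then Ḡ_τ^T is invertible. -/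
open MeasureTheory Matrix

/-- **Grönwall's inequality, integral form, homogeneous case**, forwards in time. -/
theorem eq_zero_of_le_mul_integral_of_le_s7 {f : ℝ → ℝ} (hf : Continuous f) (hf0 : ∀ t, 0 ≤ f t)
    {K s : ℝ} (h : ∀ t, s ≤ t → f t ≤ K * ∫ r in s..t, f r) {t : ℝ} (ht : s ≤ t) : f t = 0 := by
  have hu := eq_zero_of_abs_deriv_le_mul_abs_self_of_eq_zero_right
    (f := fun t => ∫ r in s..t, f r) (f' := f) (K := K) (a := s) (b := t)
    (fun x _ => (hf.integral_hasStrictDerivAt s x).hasDerivAt.continuousAt.continuousWithinAt)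
    (fun x _ => (hf.integral_hasStrictDerivAt s x).hasDerivAt.hasDerivWithinAt)
    intervalIntegral.integral_same
    (fun x hx => by
      rw [Real.norm_of_nonneg (hf0 x), Real.norm_of_nonneg
        (intervalIntegral.integral_nonneg hx.1 fun r _ => hf0 r)]
      exact h x hx.1) t ⟨ht, le_rfl⟩
  refine le_antisymm ?_ (hf0 t)
  simpa [hu] using h t ht

/-- **Grönwall's inequality, integral form, homogeneous case**, in both time directions. -/
theorem eq_zero_of_le_mul_abs_integral_s7 {f : ℝ → ℝ} (hf : Continuous f) (hf0 : ∀ t, 0 ≤ f t)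
    {K s : ℝ} (h : ∀ t, f t ≤ K * |∫ r in s..t, f r|) (t : ℝ) : f t = 0 := by
  rcases le_total s t with ht | ht
  · refine eq_zero_of_le_mul_integral_of_le_s7 hf hf0 (K := K) (fun x hx => ?_) ht
    simpa [abs_of_nonneg (intervalIntegral.integral_nonneg hx fun r _ => hf0 r)] using h x
  · have key := eq_zero_of_le_mul_integral_of_le_s7 (f := fun x => f (-x)) (K := K) (s := -s)
      (t := -t) (by fun_prop) (fun x => hf0 _) (fun x hx => ?_) (neg_le_neg ht)
    · simpa using key
    · have hint : ∫ r in (-s)..x, f (-r) = ∫ r in (-x)..s, f r := by simp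
      have hx' : -x ≤ s := by linarith
      have := h (-x)
      rwa [intervalIntegral.integral_symm, abs_neg, abs_of_nonneg
        (intervalIntegral.integral_nonneg hx' fun r _ => hf0 r), ← hint] at this

theorem intervalIntegrable_of_measurable_of_abs_le {f : ℝ → ℝ} (hf : Measurable f) {C : ℝ}
    (hC : ∀ t, |f t| ≤ C) (a b : ℝ) : IntervalIntegrable f volume a b :=
  intervalIntegrable_const (c := C) |>.mono_fun hf.aestronglyMeasurable
    (.of_forall fun t => (hC t).trans (le_abs_self C))

namespace Matrix

variable {l m n : Type*}

theorem intervalIntegrable_mul_apply [Fintype m] {A : ℝ → Matrix l m ℝ} {X : ℝ → Matrix m n ℝ}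
    {a b : ℝ} (hA : ∀ i j, IntervalIntegrable (fun t => A t i j) volume a b)
    (hX : ∀ i j, Continuous fun t => X t i j) (i : l) (j : n) :
    IntervalIntegrable (fun t => (A t * X t) i j) volume a b := by
  simp only [mul_apply]
  simpa only [Finset.sum_fn] using IntervalIntegrable.sum Finset.univ
    fun k _ => (hA i k).mul_continuousOn (hX k j).continuousOn

theorem intervalIntegrable_mul_apply_of_continuous_left [Fintype m] {A : ℝ → Matrix l m ℝ}
    {X : ℝ → Matrix m n ℝ} {a b : ℝ} (hA : ∀ i j, Continuous fun t => A t i j)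
    (hX : ∀ i j, IntervalIntegrable (fun t => X t i j) volume a b) (i : l) (j : n) :
    IntervalIntegrable (fun t => (A t * X t) i j) volume a b := by
  simp only [mul_apply]
  simpa only [Finset.sum_fn] using IntervalIntegrable.sum Finset.univ
    fun k _ => (hX k j).continuousOn_mul (hA i k).continuousOn

theorem intervalIntegral_mul_const_apply [Fintype m] {X : ℝ → Matrix l m ℝ} {a b : ℝ}
    (hX : ∀ i j, IntervalIntegrable (fun t => X t i j) volume a b) (Q : Matrix m n ℝ)
    (i : l) (j : n) :
    ∫ t in a..b, (X t * Q) i j = ∑ k, (∫ t in a..b, X t i k) * Q k j := by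
  simp only [mul_apply]
  rw [intervalIntegral.integral_finsetSum fun k _ => (hX i k).mul_const _]
  simp only [intervalIntegral.integral_mul_const]

theorem intervalIntegral_const_mul_apply [Fintype m] {X : ℝ → Matrix m n ℝ} {a b : ℝ}
    (hX : ∀ i j, IntervalIntegrable (fun t => X t i j) volume a b) (P : Matrix l m ℝ)
    (i : l) (j : n) :
    ∫ t in a..b, (P * X t) i j = ∑ k, P i k * ∫ t in a..b, X t k j := by
  simp only [mul_apply]
  rw [intervalIntegral.integral_finsetSum fun k _ => (hX k j).const_mul _]
  simp only [intervalIntegral.integral_const_mul]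

/-- The homogeneous linear Volterra equation `D t = ∫ r in s..t, A r * D r` with bounded
coefficient has only the zero solution. -/
theorem eq_zero_of_eq_integral_mul [Fintype n] {A D : ℝ → Matrix n n ℝ} {C : ℝ}
    (hA : ∀ t i j, |A t i j| ≤ C) (hD : ∀ i j, Continuous fun t => D t i j) {s : ℝ}
    (h : ∀ t i j, D t i j = ∫ r in s..t, (A r * D r) i j) (t : ℝ) : D t = 0 := by
  have hf : Continuous fun t => ∑ i, ∑ j, |D t i j| := by fun_prop
  have hentry : ∀ r i j, |(A r * D r) i j| ≤ C * ∑ i, ∑ j, |D r i j| := by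
    intro r i j
    have hC : 0 ≤ C := (abs_nonneg _).trans (hA r i j)
    calc |(A r * D r) i j| ≤ ∑ k, |A r i k * D r k j| := by
          rw [mul_apply]; exact Finset.abs_sum_le_sum_abs _ _
      _ ≤ ∑ k, C * ∑ j, |D r k j| := by
          refine Finset.sum_le_sum fun k _ => ?_
          rw [abs_mul]
          exact mul_le_mul (hA r i k) (Finset.single_le_sum (f := fun j => |D r k j|)
            (fun _ _ => abs_nonneg _) (Finset.mem_univ j)) (abs_nonneg _) hC
      _ = _ := (Finset.mul_sum _ _ _).symm
  have hbound : ∀ t i j, |D t i j| ≤ |C| * |∫ r in s..t, (∑ i, ∑ j, |D r i j|)| := by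
    intro t i j
    rw [h t i j, ← abs_mul, ← intervalIntegral.integral_const_mul]
    exact intervalIntegral.norm_integral_le_abs_of_norm_le (f := fun r => (A r * D r) i j)
      (.of_forall fun r => hentry r i j) ((hf.const_mul C).intervalIntegrable _ _)
  have hzero := eq_zero_of_le_mul_abs_integral_s7 hf
    (fun t => Finset.sum_nonneg fun i _ => Finset.sum_nonneg fun j _ => abs_nonneg _)
    (K := ∑ _i : n, ∑ _j : n, |C|) (s := s)
    (fun t => by
      simp only [Finset.sum_mul]
      exact Finset.sum_le_sum fun i _ => Finset.sum_le_sum fun j _ => hbound t i j) t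
  ext i j
  rw [Finset.sum_eq_zero_iff_of_nonneg
    fun i _ => Finset.sum_nonneg fun j _ => abs_nonneg _] at hzero
  have hi := hzero i (Finset.mem_univ i)
  rw [Finset.sum_eq_zero_iff_of_nonneg fun j _ => abs_nonneg _] at hi
  exact abs_eq_zero.mp (hi j (Finset.mem_univ j))

section FundamentalMatrix

variable [Fintype n] [DecidableEq n] {A : ℝ → Matrix n n ℝ} {Φ : ℝ → ℝ → Matrix n n ℝ} {C : ℝ}

theorem fundamentalMatrix_self
    (hΦeq : ∀ s t i j, Φ t s i j = (1 : Matrix n n ℝ) i j + ∫ r in s..t, (A r * Φ r s) i j)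
    (s : ℝ) : Φ s s = 1 := by
  ext i j
  simpa using hΦeq s s i j

/-- The cocycle property of the fundamental matrix. -/
theorem fundamentalMatrix_mul (hAmeas : ∀ i j, Measurable fun t => A t i j)
    (hA : ∀ t i j, |A t i j| ≤ C) (hΦcont : ∀ s i j, Continuous fun t => Φ t s i j)
    (hΦeq : ∀ s t i j, Φ t s i j = (1 : Matrix n n ℝ) i j + ∫ r in s..t, (A r * Φ r s) i j)
    (t s r : ℝ) : Φ t s * Φ s r = Φ t r := by
  have hint : ∀ s a b i j, IntervalIntegrable (fun t => (A t * Φ t s) i j) volume a b :=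
    fun s a b => intervalIntegrable_mul_apply (fun i j =>
      intervalIntegrable_of_measurable_of_abs_le (hAmeas i j) (fun t => hA t i j) a b) (hΦcont s)
  have hmul : ∀ t i j, (Φ t s * Φ s r) i j
      = Φ s r i j + ∫ x in s..t, (A x * Φ x s * Φ s r) i j := by
    intro t i j
    have : Φ t s = 1 + of fun i j => ∫ x in s..t, (A x * Φ x s) i j := by
      ext i j
      exact hΦeq s t i j
    rw [intervalIntegral_mul_const_apply (hint s s t), this, add_mul, one_mul, add_apply,
      mul_apply]
    rfl
  have hshift : ∀ t i j, Φ t r i j = Φ s r i j + ∫ x in s..t, (A x * Φ x r) i j := by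
    intro t i j
    rw [hΦeq r t, hΦeq r s, add_assoc,
      intervalIntegral.integral_add_adjacent_intervals (hint r r s i j) (hint r s t i j)]
  have hmulint : ∀ t i j, IntervalIntegrable (fun x => (A x * Φ x s * Φ s r) i j) volume s t :=
    fun t => intervalIntegrable_mul_apply (hint s s t) fun _ _ => continuous_const
  refine sub_eq_zero.mp (eq_zero_of_eq_integral_mul (D := fun t => Φ t s * Φ s r - Φ t r)
    (s := s) hA (fun i j => ?_) (fun t i j => ?_) t)
  · simp only [sub_apply, mul_apply]
    fun_prop
  · simp only [mul_sub, ← mul_assoc, sub_apply]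
    rw [hmul, hshift t, intervalIntegral.integral_sub (hmulint t i j) (hint r s t i j)]
    ring

theorem continuous_fundamentalMatrix_right (hAmeas : ∀ i j, Measurable fun t => A t i j)
    (hA : ∀ t i j, |A t i j| ≤ C) (hΦcont : ∀ s i j, Continuous fun t => Φ t s i j)
    (hΦeq : ∀ s t i j, Φ t s i j = (1 : Matrix n n ℝ) i j + ∫ r in s..t, (A r * Φ r s) i j)
    (t : ℝ) : Continuous fun s => Φ t s := by
  have hinv : ∀ s, Φ t s * Φ s t = 1 := fun s => by
    rw [fundamentalMatrix_mul hAmeas hA hΦcont hΦeq, fundamentalMatrix_self hΦeq]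
  have heq : (fun s => Φ t s) = fun s => (Φ s t).det⁻¹ • (Φ s t).adjugate := by
    ext1 s
    rw [← inv_eq_left_inv (hinv s), inv_def, Ring.inverse_eq_inv']
  have hc : Continuous fun s => Φ s t := continuous_matrix (hΦcont t)
  rw [heq]
  exact (hc.matrix_det.inv₀ fun s => (isUnit_det_of_left_inverse (hinv s)).ne_zero).smul
    hc.matrix_adjugate

end FundamentalMatrix

end Matrix

/-- Grammian identity under the Artstein transformation: with
`B̄(s) = Φ_A(s, s+h) B(s+h)`, the transformed Grammian
`Ḡ_τ^T = ∫_τ^T Φ_A(T,s) B̄(s) B̄(s)ᵀ Φ_A(T,s)ᵀ ds` satisfies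
`Ḡ_τ^T = Φ_A(T, T+h) G_{τ+h}^{T+h} Φ_A(T, T+h)ᵀ`; in particular it is invertible
whenever `G_{τ+h}^{T+h}` is invertible. -/
theorem grammian_artstein_identity
    (n m : ℕ)
    (A : ℝ → Matrix (Fin n) (Fin n) ℝ)
    (hAmeas : ∀ i j, Measurable fun t => A t i j)
    (hAbdd : ∃ C : ℝ, ∀ t i j, |A t i j| ≤ C)
    (Φ : ℝ → ℝ → Matrix (Fin n) (Fin n) ℝ)
    (hΦcont : ∀ s i j, Continuous fun t => Φ t s i j)
    (hΦeq : ∀ s t i j, Φ t s i j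
        = (1 : Matrix (Fin n) (Fin n) ℝ) i j + ∫ r in s..t, (A r * Φ r s) i j)
    (B : ℝ → Matrix (Fin n) (Fin m) ℝ)
    (hBmeas : ∀ i j, Measurable fun t => B t i j)
    (hBbdd : ∃ C : ℝ, ∀ t i j, |B t i j| ≤ C)
    (h : ℝ) (hh : 0 < h)
    (τ T : ℝ) (hτT : τ < T)
    (Bbar : ℝ → Matrix (Fin n) (Fin m) ℝ)
    (hBbar : ∀ s, Bbar s = Φ s (s + h) * B (s + h))
    (Gbar : Matrix (Fin n) (Fin n) ℝ)
    (hGbar : ∀ i j, Gbar i j = ∫ s in τ..T, (Φ T s * Bbar s * (Bbar s)ᵀ * (Φ T s)ᵀ) i j)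
    (Gph : Matrix (Fin n) (Fin n) ℝ)
    (hGph : ∀ i j, Gph i j
        = ∫ s in (τ + h)..(T + h), (Φ (T + h) s * B s * (B s)ᵀ * (Φ (T + h) s)ᵀ) i j) :
    Gbar = Φ T (T + h) * Gph * (Φ T (T + h))ᵀ ∧ (IsUnit Gph → IsUnit Gbar) := by
  obtain ⟨C, hA⟩ := hAbdd
  obtain ⟨K, hB⟩ := hBbdd
  have hmul := fundamentalMatrix_mul hAmeas hA hΦcont hΦeq
  have hBB : ∀ i j, IntervalIntegrable (fun t => (B t * (B t)ᵀ) i j) volume (τ + h) (T + h) := by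
    intro i j
    simp only [mul_apply, transpose_apply]
    refine intervalIntegrable_of_measurable_of_abs_le (C := ∑ _k : Fin m, K * K)
      (by fun_prop) (fun t => ?_) _ _
    refine (Finset.abs_sum_le_sum_abs _ _).trans (Finset.sum_le_sum fun k _ => ?_)
    rw [abs_mul]
    exact mul_le_mul (hB t i k) (hB t j k) (abs_nonneg _) ((abs_nonneg _).trans (hB t i k))
  have hright := continuous_fundamentalMatrix_right hAmeas hA hΦcont hΦeq (T + h)
  have hF : ∀ i j, IntervalIntegrable
      (fun s => (Φ (T + h) s * B s * (B s)ᵀ * (Φ (T + h) s)ᵀ) i j) volume (τ + h) (T + h) := by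
    simp only [Matrix.mul_assoc (Φ _ _) (B _)]
    exact intervalIntegrable_mul_apply (intervalIntegrable_mul_apply_of_continuous_left
      (fun i j => hright.matrix_elem i j) hBB) fun i j => hright.matrix_elem j i
  have hPF := intervalIntegrable_mul_apply_of_continuous_left (A := fun _ => Φ T (T + h))
    (fun _ _ => continuous_const) hF
  have hG : Gbar = Φ T (T + h) * Gph * (Φ T (T + h))ᵀ := by
    ext i j
    have hintegrand : ∀ s, Φ T s * Bbar s * (Bbar s)ᵀ * (Φ T s)ᵀ
        = Φ T (T + h) * (Φ (T + h) (s + h) * B (s + h) * (B (s + h))ᵀ * (Φ (T + h) (s + h))ᵀ)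
          * (Φ T (T + h))ᵀ := by
      intro s
      have : Φ T s * Bbar s = Φ T (T + h) * (Φ (T + h) (s + h) * B (s + h)) := by
        rw [hBbar, ← Matrix.mul_assoc, hmul, ← Matrix.mul_assoc, hmul]
      rw [Matrix.mul_assoc _ _ (Φ T s)ᵀ, ← transpose_mul, this]
      simp only [transpose_mul, Matrix.mul_assoc]
    simp only [hGbar, hintegrand]
    rw [intervalIntegral.integral_comp_add_right (fun s => (Φ T (T + h) *
      (Φ (T + h) s * B s * (B s)ᵀ * (Φ (T + h) s)ᵀ) * (Φ T (T + h))ᵀ) i j) h,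
      intervalIntegral_mul_const_apply hPF, mul_apply]
    refine Finset.sum_congr rfl fun k _ => ?_
    rw [intervalIntegral_const_mul_apply hF, mul_apply]
    simp only [hGph]
  refine ⟨hG, fun hu => ?_⟩
  have hP : IsUnit (Φ T (T + h)) := IsUnit.of_mul_eq_one (Φ (T + h) T) (by
    rw [hmul, fundamentalMatrix_self hΦeq])
  rw [hG]
  exact (hP.mul hu).mul ((isUnit_iff_isUnit_det _).mpr (by rwa [det_transpose, ← isUnit_iff_isUnit_det]))
end

section
/- Open-loop controllability of the non-delayed linear system with drift: let A : ℝ → Matrix (Fin n) (Fin n) ℝ, B : ℝ → Matrix (Fin n) (Fin m) ℝ and r : ℝ → ℝⁿ be measurable and bounded, let T > 0, and assume the Grammian G := ∫_{0}^{T} Φ_A(T, s) B(s) B(s)ᵀ Φ_A(T, s)ᵀ ds is invertible. Given x₀, x_T ∈ ℝⁿ, define the control u(t) := B(t)ᵀ Φ_A(T, t)ᵀ G⁻¹ (x_T − Φ_A(T, 0) x₀ − ∫_{0}^{T} Φ_A(T, s) r(s) ds). Then the trajectory x(t) := Φ_A(t, 0) x₀ + ∫_{0}^{t} Φ_A(t,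 s) (B(s) u(s) + r(s)) ds, which is the solution of x' = A x + B u + r with x(0) = x₀, satisfies x(T) = x_T. -/
open MeasureTheory Matrix

section EssentiallyBounded

variable {α ι κ l : Type*} [MeasurableSpace α] {μ : Measure α} [Fintype κ]

theorem memLp_top_matrix_mul {M : α → Matrix ι κ ℝ} {N : α → Matrix κ l ℝ}
    (hM : ∀ i j, MemLp (fun s => M s i j) ⊤ μ) (hN : ∀ i j, MemLp (fun s => N s i j) ⊤ μ)
    (i : ι) (j : l) : MemLp (fun s => (M s * N s) i j) ⊤ μ := by
  simp only [Matrix.mul_apply]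
  exact memLp_finsetSum _ fun k _ => (hN k j).mul' (hM i k)

theorem memLp_top_mulVec {M : α → Matrix ι κ ℝ} {v : α → κ → ℝ}
    (hM : ∀ i j, MemLp (fun s => M s i j) ⊤ μ) (hv : ∀ j, MemLp (fun s => v s j) ⊤ μ)
    (i : ι) : MemLp (fun s => (M s).mulVec (v s) i) ⊤ μ := by
  simp only [Matrix.mulVec, dotProduct]
  exact memLp_finsetSum _ fun k _ => (hv k).mul' (hM i k)

end EssentiallyBounded

theorem memLp_top_of_continuousOn_Icc {f : ℝ → ℝ} {a b : ℝ}
    (hf : ContinuousOn f (Set.Icc a b)) :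
    MemLp f ⊤ (volume.restrict (Set.Icc a b)) := by
  obtain ⟨C, hC⟩ := isCompact_Icc.exists_bound_of_continuousOn hf
  exact memLp_top_of_bound (hf.aestronglyMeasurable measurableSet_Icc) C
    ((ae_restrict_iff' measurableSet_Icc).2 (.of_forall hC))

theorem intervalIntegrable_of_memLp_top {f : ℝ → ℝ} {a b : ℝ} (hab : a ≤ b)
    (hf : MemLp f ⊤ (volume.restrict (Set.Icc a b))) : IntervalIntegrable f volume a b := by
  rw [intervalIntegrable_iff_integrableOn_Icc_of_le hab]
  exact hf.integrable le_top

theorem intervalIntegrable_pi {ι : Type*} [Fintype ι] {f : ℝ → ι → ℝ} {a b : ℝ}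
    (hf : ∀ i, IntervalIntegrable (fun s => f s i) volume a b) :
    IntervalIntegrable f volume a b :=
  ⟨Integrable.of_eval fun i => (hf i).1, Integrable.of_eval fun i => (hf i).2⟩

theorem intervalIntegral_pi_apply_s8 {ι : Type*} [Fintype ι] {f : ℝ → ι → ℝ} {a b : ℝ}
    (hf : ∀ i, IntervalIntegrable (fun s => f s i) volume a b) (i : ι) :
    (∫ s in a..b, f s) i = ∫ s in a..b, f s i :=
  ((ContinuousLinearMap.proj (R := ℝ) (φ := fun _ : ι => ℝ) i).intervalIntegral_comp_comm
    (intervalIntegrable_pi hf)).symm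

section LinearIntegralEquation

variable {n : ℕ} {A : ℝ → Matrix (Fin n) (Fin n) ℝ}

/-- A continuous solution of the homogeneous linear integral equation started at `0` vanishes
in forward time. -/
theorem linear_integral_equation_eq_zero
    (hAbdd : ∃ C : ℝ, ∀ t i j, |A t i j| ≤ C) {D : ℝ → Matrix (Fin n) (Fin n) ℝ} {a : ℝ}
    (hD : ∀ i j, Continuous fun t => D t i j)
    (hDeq : ∀ t, a ≤ t → ∀ i j, D t i j = ∫ q in a..t, (A q * D q) i j)
    {t : ℝ} (ht : a ≤ t) : D t = 0 := by
  obtain ⟨C, hC⟩ := hAbdd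
  set g : ℝ → ℝ := fun t => ∑ i, ∑ j, |D t i j| with hg
  have hgc : Continuous g :=
    continuous_finsetSum _ fun i _ => continuous_finsetSum _ fun j _ => (hD i j).abs
  have hg0 : ∀ t, 0 ≤ g t := fun t =>
    Finset.sum_nonneg fun i _ => Finset.sum_nonneg fun j _ => abs_nonneg _
  have hle : ∀ t i j, |D t i j| ≤ g t := fun t i j =>
    (Finset.single_le_sum (f := fun j => |D t i j|) (fun _ _ => abs_nonneg _)
      (Finset.mem_univ j)).trans
    (Finset.single_le_sum (f := fun i => ∑ j, |D t i j|)
      (fun _ _ => Finset.sum_nonneg fun _ _ => abs_nonneg _) (Finset.mem_univ i))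
  have hmul : ∀ q i j, |(A q * D q) i j| ≤ (n * C) * g q := fun q i j => by
    rw [Matrix.mul_apply]
    calc |∑ k, A q i k * D q k j| ≤ ∑ k, |A q i k * D q k j| := Finset.abs_sum_le_sum_abs _ _
      _ ≤ ∑ _k : Fin n, C * g q := Finset.sum_le_sum fun k _ => by
        rw [abs_mul]
        exact mul_le_mul (hC q i k) (hle q k j) (abs_nonneg _) ((abs_nonneg _).trans (hC q i k))
      _ = (n * C) * g q := by simp [mul_assoc]
  have hbd : ∀ t, a ≤ t → g t ≤ (n * (n * (n * C))) * ∫ q in a..t, g q := fun t ht => by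
    have hint : ∀ i j, |D t i j| ≤ (n * C) * ∫ q in a..t, g q := fun i j => by
      rw [hDeq t ht i j, ← intervalIntegral.integral_const_mul]
      exact intervalIntegral.norm_integral_le_of_norm_le
        (f := fun q => (A q * D q) i j) ht (.of_forall fun q _ => hmul q i j)
        ((hgc.const_mul (n * C)).intervalIntegrable _ _)
    calc g t ≤ ∑ _i : Fin n, ∑ _j : Fin n, (n * C) * ∫ q in a..t, g q :=
        Finset.sum_le_sum fun i _ => Finset.sum_le_sum fun j _ => hint i j
      _ = _ := by simp [mul_assoc]
  have hF0 : ∫ q in a..t, g q = 0 := by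
    refine eq_zero_of_abs_deriv_le_mul_abs_self_of_eq_zero_right
      (f := fun t => ∫ q in a..t, g q) (f' := g) (K := n * (n * (n * C))) (a := a) (b := t)
      (intervalIntegral.continuous_primitive
        (fun _ _ => hgc.intervalIntegrable _ _) a).continuousOn
      (fun x _ => (hgc.integral_hasStrictDerivAt a x).hasDerivAt.hasDerivWithinAt)
      intervalIntegral.integral_same (fun x hx => ?_) t ⟨ht, le_rfl⟩
    rw [Real.norm_of_nonneg (hg0 x),
      Real.norm_of_nonneg (intervalIntegral.integral_nonneg hx.1 fun q _ => hg0 q)]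
    exact hbd x hx.1
  have hgt : g t ≤ 0 := by simpa [hF0] using hbd t ht
  ext i j
  exact abs_nonpos_iff.1 ((hle t i j).trans hgt)

theorem memLp_top_entry_of_bounded {ι κ : Type*} {M : ℝ → Matrix ι κ ℝ} {μ : Measure ℝ}
    (hmeas : ∀ i j, Measurable fun t => M t i j)
    (hbdd : ∃ C : ℝ, ∀ t i j, |M t i j| ≤ C) (i : ι) (j : κ) :
    MemLp (fun t => M t i j) ⊤ μ :=
  let ⟨C, hC⟩ := hbdd
  memLp_top_of_bound (hmeas i j).aestronglyMeasurable C (.of_forall fun t => hC t i j)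

variable {Φ : ℝ → ℝ → Matrix (Fin n) (Fin n) ℝ}

theorem intervalIntegrable_mul_of_continuous
    (hAmeas : ∀ i j, Measurable fun t => A t i j)
    (hAbdd : ∃ C : ℝ, ∀ t i j, |A t i j| ≤ C) {X : ℝ → Matrix (Fin n) (Fin n) ℝ}
    (hX : ∀ i j, Continuous fun t => X t i j) (i j : Fin n) (a b : ℝ) :
    IntervalIntegrable (fun q => (A q * X q) i j) volume a b := by
  have key : ∀ a b : ℝ, a ≤ b → IntervalIntegrable (fun q => (A q * X q) i j) volume a b :=
    fun a b hab => intervalIntegrable_of_memLp_top hab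
      (memLp_top_matrix_mul (memLp_top_entry_of_bounded hAmeas hAbdd)
        (fun i j => memLp_top_of_continuousOn_Icc (hX i j).continuousOn) i j)
  rcases le_total a b with h | h
  · exact key a b h
  · exact (key b a h).symm

/-- The cocycle identity of the fundamental matrix, in forward time. -/
theorem fundamental_matrix_cocycle
    (hAmeas : ∀ i j, Measurable fun t => A t i j)
    (hAbdd : ∃ C : ℝ, ∀ t i j, |A t i j| ≤ C)
    (hΦcont : ∀ s i j, Continuous fun t => Φ t s i j)
    (hΦeq : ∀ s t i j, Φ t s i j
        = (1 : Matrix (Fin n) (Fin n) ℝ) i j + ∫ q in s..t, (A q * Φ q s) i j)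
    (s : ℝ) {a t : ℝ} (hat : a ≤ t) : Φ t s = Φ t a * Φ a s := by
  have hint : ∀ s i j a b, IntervalIntegrable (fun q => (A q * Φ q s) i j) volume a b :=
    fun s => intervalIntegrable_mul_of_continuous hAmeas hAbdd (hΦcont s)
  have hprod : ∀ i j, Continuous fun t => (Φ t a * Φ a s) i j := fun i j => by
    simp only [Matrix.mul_apply]
    exact continuous_finsetSum _ fun k _ => (hΦcont a i k).mul continuous_const
  refine sub_eq_zero.1 (linear_integral_equation_eq_zero hAbdd
    (D := fun t => Φ t s - Φ t a * Φ a s) (a := a) (fun i j => ?_) (fun t _ i j => ?_) hat)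
  · exact (hΦcont s i j).sub (hprod i j)
  · have h1 : Φ t s i j = Φ a s i j + ∫ q in a..t, (A q * Φ q s) i j := by
      rw [hΦeq s t, hΦeq s a, add_assoc,
        intervalIntegral.integral_add_adjacent_intervals (hint s i j s a) (hint s i j a t)]
    have h2 : (Φ t a * Φ a s) i j = Φ a s i j + ∫ q in a..t, (A q * (Φ q a * Φ a s)) i j := by
      simp only [← Matrix.mul_assoc]
      simp only [Matrix.mul_apply (N := Φ a s)]
      rw [intervalIntegral.integral_finsetSum fun k _ => (hint a i k a t).mul_const _]
      simp only [intervalIntegral.integral_mul_const]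
      conv_lhs => enter [2, k]; rw [hΦeq a t i k, add_mul]
      rw [Finset.sum_add_distrib, ← Matrix.mul_apply, Matrix.one_mul]
    simp only [Matrix.mul_sub, Matrix.sub_apply]
    rw [intervalIntegral.integral_sub (hint s i j a t)
      (intervalIntegrable_mul_of_continuous hAmeas hAbdd hprod i j a t), h1, h2]
    ring

/-- The fundamental matrix is continuous in its initial time. -/
theorem continuousOn_fundamental_matrix
    (hAmeas : ∀ i j, Measurable fun t => A t i j)
    (hAbdd : ∃ C : ℝ, ∀ t i j, |A t i j| ≤ C)
    (hΦcont : ∀ s i j, Continuous fun t => Φ t s i j)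
    (hΦeq : ∀ s t i j, Φ t s i j
        = (1 : Matrix (Fin n) (Fin n) ℝ) i j + ∫ q in s..t, (A q * Φ q s) i j)
    {a b : ℝ} (hab : a ≤ b) (i j : Fin n) :
    ContinuousOn (fun s => Φ b s i j) (Set.Icc a b) := by
  have hcoc := fun s {c t : ℝ} (h : c ≤ t) =>
    fundamental_matrix_cocycle hAmeas hAbdd hΦcont hΦeq s h
  have hone : ∀ s, a ≤ s → Φ s a * Φ a s = 1 := fun s hs => by
    rw [← hcoc s hs]
    ext i j
    rw [hΦeq s s, intervalIntegral.integral_same, add_zero]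
  have hc : Continuous fun s => Φ s a := continuous_matrix (hΦcont a)
  have hinv : ContinuousOn (fun s => (Φ b a * (Φ s a)⁻¹) i j) (Set.Icc a b) := by
    have h : ContinuousOn (fun s => Φ b a * (((Φ s a).det)⁻¹ • (Φ s a).adjugate))
        (Set.Icc a b) := by
      refine continuousOn_const.mul (ContinuousOn.smul (hc.matrix_det.continuousOn.inv₀ ?_)
        hc.matrix_adjugate.continuousOn)
      intro s hs h0
      simpa [h0] using congrArg Matrix.det (hone s hs.1)
    simp only [Matrix.inv_def, Ring.inverse_eq_inv']
    exact (continuous_id.matrix_elem i j).comp_continuousOn h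
  refine hinv.congr fun s hs => ?_
  beta_reduce
  rw [Matrix.inv_eq_right_inv (hone s hs.1)]
  exact congrFun (congrFun (hcoc s hab) i) j

end LinearIntegralEquation

/-- Open-loop controllability of the non-delayed linear system with drift: with an
invertible Grammian `G`, the Grammian-based open-loop control
`u(t) = B(t)ᵀ Φ_A(T,t)ᵀ G⁻¹ (x_T − Φ_A(T,0) x₀ − ∫_0^T Φ_A(T,s) r(s) ds)` steers the
trajectory `x(t) = Φ_A(t,0) x₀ + ∫_0^t Φ_A(t,s) (B(s) u(s) + r(s)) ds` of
`x' = A x + B u + r`, `x(0) = x₀`, to `x(T) = x_T`. -/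
theorem open_loop_controllability_nondelayed
    (n m : ℕ)
    (A : ℝ → Matrix (Fin n) (Fin n) ℝ)
    (hAmeas : ∀ i j, Measurable fun t => A t i j)
    (hAbdd : ∃ C : ℝ, ∀ t i j, |A t i j| ≤ C)
    (Φ : ℝ → ℝ → Matrix (Fin n) (Fin n) ℝ)
    (hΦcont : ∀ s i j, Continuous fun t => Φ t s i j)
    (hΦeq : ∀ s t i j, Φ t s i j
        = (1 : Matrix (Fin n) (Fin n) ℝ) i j + ∫ q in s..t, (A q * Φ q s) i j)
    (B : ℝ → Matrix (Fin n) (Fin m) ℝ)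
    (hBmeas : ∀ i j, Measurable fun t => B t i j)
    (hBbdd : ∃ C : ℝ, ∀ t i j, |B t i j| ≤ C)
    (r : ℝ → Fin n → ℝ)
    (hrmeas : ∀ i, Measurable fun t => r t i)
    (hrbdd : ∃ C : ℝ, ∀ t i, |r t i| ≤ C)
    (T : ℝ) (hT : 0 < T)
    (G : Matrix (Fin n) (Fin n) ℝ)
    (hG : ∀ i j, G i j = ∫ s in (0 : ℝ)..T, (Φ T s * B s * (B s)ᵀ * (Φ T s)ᵀ) i j)
    (hGinv : IsUnit G.det)
    (x₀ xT : Fin n → ℝ)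
    (u : ℝ → Fin m → ℝ)
    (hu : ∀ t, u t = (B t)ᵀ.mulVec ((Φ T t)ᵀ.mulVec (G⁻¹.mulVec
        (xT - (Φ T 0).mulVec x₀ - ∫ s in (0 : ℝ)..T, (Φ T s).mulVec (r s)))))
    (x : ℝ → Fin n → ℝ)
    (hx : ∀ t, x t = (Φ t 0).mulVec x₀
        + ∫ s in (0 : ℝ)..t, (Φ t s).mulVec ((B s).mulVec (u s) + r s)) :
    x T = xT := by
  have hΦ : ∀ i j, MemLp (fun s => Φ T s i j) ⊤ (volume.restrict (Set.Icc 0 T)) := fun i j =>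
    memLp_top_of_continuousOn_Icc
      (continuousOn_fundamental_matrix hAmeas hAbdd hΦcont hΦeq hT.le i j)
  have hB : ∀ i j, MemLp (fun s => B s i j) ⊤ (volume.restrict (Set.Icc 0 T)) :=
    memLp_top_entry_of_bounded hBmeas hBbdd
  have hr : ∀ i, MemLp (fun s => r s i) ⊤ (volume.restrict (Set.Icc 0 T)) := fun i =>
    let ⟨C, hC⟩ := hrbdd
    memLp_top_of_bound (hrmeas i).aestronglyMeasurable C (.of_forall fun t => hC t i)
  have hΦr : ∀ i, IntervalIntegrable (fun s => (Φ T s).mulVec (r s) i) volume 0 T := fun i =>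
    intervalIntegrable_of_memLp_top hT.le (memLp_top_mulVec hΦ hr i)
  have hgram : ∀ i j, IntervalIntegrable
      (fun s => (Φ T s * B s * (B s)ᵀ * (Φ T s)ᵀ) i j) volume 0 T := fun i j =>
    intervalIntegrable_of_memLp_top hT.le
      (memLp_top_matrix_mul (memLp_top_matrix_mul (memLp_top_matrix_mul hΦ hB)
        fun i j => hB j i) (fun i j => hΦ j i) i j)
  set w : Fin n → ℝ := xT - (Φ T 0).mulVec x₀ - ∫ s in (0 : ℝ)..T, (Φ T s).mulVec (r s) with hw
  set v : Fin n → ℝ := G⁻¹.mulVec w with hv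
  have hGv : G.mulVec v = w := by
    rw [hv, Matrix.mulVec_mulVec, Matrix.mul_nonsing_inv _ hGinv, Matrix.one_mulVec]
  have hgramv : ∀ i, IntervalIntegrable
      (fun s => (Φ T s * B s * (B s)ᵀ * (Φ T s)ᵀ).mulVec v i) volume 0 T := fun i => by
    have h := IntervalIntegrable.sum Finset.univ fun j _ => (hgram i j).mul_const (v j)
    rwa [Finset.sum_fn] at h
  have hintGv : ∫ s in (0 : ℝ)..T, (Φ T s * B s * (B s)ᵀ * (Φ T s)ᵀ).mulVec v = w := by
    rw [← hGv]
    ext i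
    rw [intervalIntegral_pi_apply_s8 hgramv]
    simp only [Matrix.mulVec, dotProduct]
    rw [intervalIntegral.integral_finsetSum fun j _ => (hgram i j).mul_const _]
    simp only [intervalIntegral.integral_mul_const, hG]
  have hsplit : ∀ s, (Φ T s).mulVec ((B s).mulVec (u s) + r s)
      = (Φ T s * B s * (B s)ᵀ * (Φ T s)ᵀ).mulVec v + (Φ T s).mulVec (r s) := fun s => by
    rw [Matrix.mulVec_add, hu]
    simp only [Matrix.mulVec_mulVec, Matrix.mul_assoc]
  rw [hx T]
  simp only [hsplit]
  rw [intervalIntegral.integral_add (intervalIntegrable_pi hgramv)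
    (intervalIntegrable_pi hΦr), hintGv, hw]
  abel
end
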